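/- The series ∑_{n=0}^∞ ((1/2)_n (1/4)_n (3/4)_n)/((1)_n^3) · (-1/4)^n equals (2/25)·5^{1/4}·(5+√5)·π / (Γ(11/20)²·Γ(19/20)²). -/

import Mathlib

open Real

noncomputable def poch (a : ℝ) (n : ℕ) : ℝ := (ascPochhammer ℝ n).eval a

open Filter Topology

lemma poch_zero (a : ℝ) : poch a 0 = 1 := by simp [poch]

lemma poch_succ (a : ℝ) (n : ℕ) : poch a (n+1) = poch a n * (a + n) := by
  simp [poch, ascPochhammer_succ_eval]

lemma poch_pos {a : ℝ} (ha : 0 < a) (n : ℕ) : 0 < poch a n := by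
  induction n with
  | zero => simp [poch_zero]
  | succ n ih => rw [poch_succ]; positivity

lemma poch_left (a : ℝ) (n : ℕ) : a * poch (a+1) n = poch a n * (a + n) := by
  induction n with
  | zero => simp [poch_zero]
  | succ n ih =>
    rw [poch_succ, poch_succ, ← mul_assoc, ih]; push_cast; ring

/-- The hypergeometric terms on the special line. -/
noncomputable def TT (t : ℝ) (n : ℕ) : ℝ :=
  poch (1/8-t) n * poch (5/8-t) n / (poch (1+4*t) n * poch 1 n) * (1/5)^n

lemma TT_zero (t : ℝ) : TT t 0 = 1 := by simp [TT, poch_zero]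

lemma TT_succ {t : ℝ} (ht : 0 ≤ t) (n : ℕ) :
    5 * (n+1) * (1+4*t+n) * TT t (n+1) = (1/8-t+n) * (5/8-t+n) * TT t n := by
  have h1 := poch_pos (show 0 < 1+4*t by positivity) n
  have h2 := poch_pos (show (0:ℝ) < 1 by positivity) n
  have h3 : 0 < 1+4*t+n := by positivity
  have h4 : (0:ℝ) < 1+n := by positivity
  simp only [TT, poch_succ, pow_succ]
  field_simp
  ring

lemma poch_four (c : ℝ) (n : ℕ) :
    c*(c+1)*(c+2)*(c+3) * poch (c+4) n = poch c n * ((c+n)*(c+n+1)*(c+n+2)*(c+n+3)) := by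
  have e1 := poch_left c n
  have e2 := poch_left (c+1) n
  have e3 := poch_left (c+2) n
  have e4 := poch_left (c+3) n
  rw [show c+1+1 = c+2 by ring] at e2
  rw [show c+2+1 = c+3 by ring] at e3
  rw [show c+3+1 = c+4 by ring] at e4
  linear_combination c*(c+1)*(c+2)*e4 + c*(c+1)*(c+3+n)*e3 + c*(c+3+n)*(c+2+n)*e2
    + (c+3+n)*(c+2+n)*(c+1+n)*e1

lemma TT_shift {t : ℝ} (ht : 0 ≤ t) (n : ℕ) :
    (-7/8-t) * (-3/8-t) * ((1+4*t)*(2+4*t)*(3+4*t)*(4+4*t)) * TT t n =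
      (-7/8-t+n) * (-3/8-t+n) * ((1+4*t+n)*(2+4*t+n)*(3+4*t+n)*(4+4*t+n)) * TT (t+1) n := by
  have h1 := poch_pos (show 0 < 1+4*t by positivity) n
  have h1' := poch_pos (show 0 < 1+4*t+4 by positivity) n
  have h2 := poch_pos (show (0:ℝ) < 1 by positivity) n
  have ea := poch_left (-7/8-t) n
  have eb := poch_left (-3/8-t) n
  have ec := poch_four (1+4*t) n
  rw [show -7/8-t+1 = 1/8-t by ring] at ea
  rw [show -3/8-t+1 = 5/8-t by ring] at eb
  simp only [TT]
  rw [show 1/8-(t+1) = -7/8-t by ring, show 5/8-(t+1) = -3/8-t by ring,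
    show 1+4*(t+1) = 1+4*t+4 by ring]
  generalize poch (1+4*t+4) n = p4 at *
  generalize poch (1+4*t) n = p0 at *
  generalize poch 1 n = p1 at *
  generalize poch (1/8-t) n = pa at *
  generalize poch (5/8-t) n = pb at *
  generalize poch (-7/8-t) n = pa' at *
  generalize poch (-3/8-t) n = pb' at *
  generalize ((1:ℝ)/5)^n = z
  rw [div_mul_eq_mul_div, div_mul_eq_mul_div, mul_div_assoc', mul_div_assoc',
    div_eq_div_iff (by positivity) (by positivity)]
  linear_combination (p1*z*p4*pb*(-3/8-t)*((1+4*t)*(2+4*t)*(3+4*t)*(4+4*t))) * ea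
    + (p1*z*p4*pa'*(-7/8-t+n)*((1+4*t)*(2+4*t)*(3+4*t)*(4+4*t))) * eb
    + (p1*z*pa'*pb'*(-7/8-t+n)*(-3/8-t+n)) * ec

lemma geom_summable {u : ℕ → ℝ} (h : ∀ᶠ n in atTop, |u (n+1)| ≤ 1/2 * |u n|) (k : ℕ) :
    Summable (fun n : ℕ => (n:ℝ)^k * u n) := by
  obtain ⟨N, hN⟩ := eventually_atTop.1 h
  have hb : ∀ m, |u (N+m)| ≤ (1/2)^m * |u N| := by
    intro m
    induction m with
    | zero => simp
    | succ m ih =>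
      have := hN (N+m) (by omega)
      rw [← add_assoc]
      calc _ ≤ _ := this
        _ ≤ 1/2 * ((1/2)^m * |u N|) := by gcongr
        _ = _ := by ring
  have hs : Summable (fun n : ℕ => (n:ℝ)^k * (1/2:ℝ)^n) :=
    summable_pow_mul_geometric_of_norm_lt_one k (by norm_num)
  have hs2 := ((summable_nat_add_iff N).2 hs).mul_right (2^N * |u N|)
  rw [← summable_nat_add_iff N]
  refine Summable.of_norm_bounded hs2 ?_
  intro m
  rw [norm_mul, Real.norm_eq_abs, Real.norm_eq_abs, abs_of_nonneg (by positivity)]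
  simp only [add_comm m N]
  have := hb m
  calc _ ≤ ((N+m : ℕ):ℝ)^k * ((1/2)^m * |u N|) := by gcongr
    _ = _ := by
      have h2 : (1/2:ℝ)^N * 2^N = 1 := by rw [← mul_pow]; norm_num
      rw [pow_add]
      linear_combination (-((N+m : ℕ):ℝ)^k * (1/2)^m * |u N|) * h2

lemma TT_ratio {t : ℝ} (ht : 0 ≤ t) : ∀ᶠ n in atTop, |TT t (n+1)| ≤ 1/2 * |TT t n| := by
  filter_upwards [eventually_ge_atTop (⌈t⌉₊ + 1)] with n hn
  have hn' : t + 1 ≤ n := by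
    have h1 : t ≤ ⌈t⌉₊ := Nat.le_ceil t
    have h2 : ((⌈t⌉₊ + 1 : ℕ) : ℝ) ≤ n := by exact_mod_cast hn
    push_cast at h2; linarith
  have h := congrArg abs (TT_succ ht n)
  rw [abs_mul _ (TT t (n+1)), abs_mul _ (TT t n), abs_of_nonneg (by positivity : (0:ℝ) ≤ 5 * (n+1) * (1+4*t+n)),
    abs_of_nonneg (mul_nonneg (by linarith) (by linarith) : (0:ℝ) ≤ (1/8-t+n)*(5/8-t+n))] at h
  have hD : (0:ℝ) < 5 * (n+1) * (1+4*t+n) := by positivity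
  have hle : (1/8-t+n)*(5/8-t+n) ≤ 1/2 * (5 * (n+1) * (1+4*t+n)) := by
    have : (1/8-t+n)*(5/8-t+n) ≤ (n+1) * (1+4*t+n) := by
      apply mul_le_mul <;> nlinarith
    nlinarith
  have := mul_le_mul_of_nonneg_right hle (abs_nonneg (TT t n))
  rw [← h] at this
  refine le_of_mul_le_mul_left ?_ hD
  linarith

lemma TT_summable_pow {t : ℝ} (ht : 0 ≤ t) (k : ℕ) : Summable (fun n : ℕ => (n:ℝ)^k * TT t n) :=
  geom_summable (TT_ratio ht) k

lemma TT_summable {t : ℝ} (ht : 0 ≤ t) : Summable (TT t) := by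
  simpa using TT_summable_pow ht 0

noncomputable def SS (t : ℝ) : ℝ := ∑' n, TT t n

lemma SS_rec {t : ℝ} (ht : 0 ≤ t) :
    (40*t+11)*(40*t+19)*(40*t+31)*(40*t+39) * SS (t+1) =
      2^18/25 * ((1+4*t)*(2+4*t)*(3+4*t)*(4+4*t)) * SS t := by
  have ht1 : 0 ≤ t+1 := by linarith
  set q : ℝ → ℝ := fun n => (-32163) + (-1520736/5)*t^1 + (-4863104/5)*t^2 + (-6486016/5)*t^3
    + (-3108864/5)*t^4 + (-360944/5)*n^1 + (-1638272/5)*n^1*t^1 + (-2429952/5)*n^1*t^2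
    + (-1286144/5)*n^1*t^3 + (190976/5)*n^2 + (1073152/5)*n^2*t^1 + (1212416/5)*n^2*t^2
    + (290816/5)*n^3 + (557056/5)*n^3*t^1 + (65536/5)*n^4 with hq
  set G : ℕ → ℝ := fun n => q n * (n * (4+4*t+n)) * TT (t+1) n with hG
  have hGs : Summable G := by
    have s := TT_summable_pow ht1
    have e : G = fun n : ℕ =>
       (4+4*t) * ((-32163) + (-1520736/5)*t^1 + (-4863104/5)*t^2 + (-6486016/5)*t^3 + (-3108864/5)*t^4) * ((n:ℝ)^1 * TT (t+1) n)
       + ((4+4*t) * ((-360944/5) + (-1638272/5)*t^1 + (-2429952/5)*t^2 + (-1286144/5)*t^3) + ((-32163) + (-1520736/5)*t^1 + (-4863104/5)*t^2 + (-6486016/5)*t^3 + (-3108864/5)*t^4)) * ((n:ℝ)^2 * TT (t+1) n)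
       + ((4+4*t) * ((190976/5) + (1073152/5)*t^1 + (1212416/5)*t^2) + ((-360944/5) + (-1638272/5)*t^1 + (-2429952/5)*t^2 + (-1286144/5)*t^3)) * ((n:ℝ)^3 * TT (t+1) n)
       + ((4+4*t) * ((290816/5) + (557056/5)*t^1) + ((190976/5) + (1073152/5)*t^1 + (1212416/5)*t^2)) * ((n:ℝ)^4 * TT (t+1) n)
       + ((4+4*t) * (65536/5) + ((290816/5) + (557056/5)*t^1)) * ((n:ℝ)^5 * TT (t+1) n)
       + (65536/5) * ((n:ℝ)^6 * TT (t+1) n) := by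
      funext n; simp only [hG, hq]; ring
    rw [e]
    exact ((((((s 1).mul_left _).add ((s 2).mul_left _)).add ((s 3).mul_left _)).add
      ((s 4).mul_left _)).add ((s 5).mul_left _)).add ((s 6).mul_left _)
  have hG0 : G 0 = 0 := by simp [hG]
  have key : ∀ n, G (n+1) - G n = (-7/8-t)*(-3/8-t)*((40*t+11)*(40*t+19)*(40*t+31)*(40*t+39)) * TT (t+1) n
      - 2^18/25 * ((-7/8-t) * (-3/8-t) * ((1+4*t)*(2+4*t)*(3+4*t)*(4+4*t)) * TT t n) := by
    intro n
    rw [TT_shift ht n]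
    have h := TT_succ ht1 n
    simp only [hG, hq]
    push_cast
    linear_combination (1/5) * q (n+1) * h
  have hsum : ∑' n, (G (n+1) - G n) = 0 := by
    rw [(((summable_nat_add_iff 1).2 hGs)).tsum_sub hGs]
    have := hGs.tsum_eq_zero_add
    rw [hG0] at this
    linarith
  simp_rw [key] at hsum
  rw [((TT_summable ht1).mul_left _).tsum_sub (((TT_summable ht).mul_left _).mul_left _),
    tsum_mul_left, tsum_mul_left, tsum_mul_left] at hsum
  have hne : (-7/8-t)*(-3/8-t) ≠ 0 := by
    have : 0 < (7/8+t)*(3/8+t) := by positivity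
    nlinarith
  apply mul_left_cancel₀ hne
  simp only [SS]
  linarith

noncomputable def al : ℝ := (5 * √5 - 11) / 4

lemma sqrt5_sq : √5 ^ 2 = 5 := Real.sq_sqrt (by norm_num)

lemma al_pos : 0 < al := by
  have h := sqrt5_sq
  have h0 : 0 ≤ √5 := Real.sqrt_nonneg 5
  unfold al
  nlinarith

lemma al_lt : al < 1/4 := by
  have h := sqrt5_sq
  have h0 : 0 ≤ √5 := Real.sqrt_nonneg 5
  unfold al
  nlinarith

lemma al_eq : 4 * al^2 + 22 * al = 1 := by
  have h := sqrt5_sq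
  unfold al
  linear_combination (25/4) * h

lemma conc {t : ℝ} (ht : 10 ≤ t) (hT : ∀ n, 0 ≤ TT t n) :
    Summable (fun n : ℕ => ((n:ℝ) - al*t)^2 * TT t n) ∧
    ∑' n : ℕ, ((n:ℝ) - al*t)^2 * TT t n ≤ t * SS t := by
  have ht0 : 0 ≤ t := by linarith
  have s := TT_summable_pow ht0
  have s0 := TT_summable ht0
  have sX : Summable (fun n : ℕ => ((n:ℝ) - al*t)^2 * TT t n) := by
    have e : (fun n : ℕ => ((n:ℝ) - al*t)^2 * TT t n) = fun n : ℕ =>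
      (n:ℝ)^2 * TT t n - (2*al*t) * ((n:ℝ)^1 * TT t n) + (al*t)^2 * TT t n := by
      funext n; ring
    rw [e]
    exact ((s 2).sub ((s 1).mul_left _)).add (s0.mul_left _)
  refine ⟨sX, ?_⟩
  set H : ℕ → ℝ := fun n => 5 * n * (n+4*t) * (n - al*t) * TT t n with hH
  have sH : Summable H := by
    have e : H = fun n : ℕ => 5 * ((n:ℝ)^3 * TT t n) + 5 * (4*t-al*t) * ((n:ℝ)^2 * TT t n)
      + (-20 * al * t^2) * ((n:ℝ)^1 * TT t n) := by
      funext n; simp only [hH]; ring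
    rw [e]
    exact (((s 3).mul_left _).add ((s 2).mul_left _)).add ((s 1).mul_left _)
  have hsum : ∑' n, (H n - H (n+1)) = 0 := by
    rw [sH.tsum_sub ((summable_nat_add_iff 1).2 sH)]
    have := sH.tsum_eq_zero_add
    rw [show H 0 = 0 by simp [hH]] at this
    linarith
  have hpt : ∀ n : ℕ, (20*t-10) * (((n:ℝ) - al*t)^2 * TT t n) - 10*t^2 * TT t n ≤ H n - H (n+1) := by
    intro n
    have h := TT_succ ht0 n
    have e : H n - H (n+1) = (5*n*(n+4*t)*(n-al*t) - (1/8-t+n)*(5/8-t+n)*(n+1-al*t)) * TT t n := by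
      simp only [hH]; push_cast
      linear_combination (-(n+1-al*t)) * h
    rw [e]
    have hn : (0:ℝ) ≤ n := Nat.cast_nonneg n
    have hmain : (20*t-10) * ((n:ℝ) - al*t)^2 - 10*t^2 ≤
        (5*n*(n+4*t)*(n-al*t) - (1/8-t+n)*(5/8-t+n)*(n+1-al*t)) := by
      have e1 : 5*n*(n+4*t)*(n-al*t) - (1/8-t+n)*(5/8-t+n)*(n+1-al*t) =
        4*(n-al*t)^2*(n+(al+11/2)*t) - ((n-al*t)*(3/4*((n-al*t)-(1-al)*t)+5/64)
          + ((n-al*t)-(1-al)*t+1/8)*((n-al*t)-(1-al)*t+5/8)) := by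
        linear_combination (t^2*(n-al*t)) * al_eq
      rw [e1]
      set X : ℝ := n - al*t with hX
      set u : ℝ := (1-al)*t with hu
      have hu0 : 0 ≤ u := mul_nonneg (by linarith [al_lt]) ht0
      have hut : u ≤ t := by rw [hu]; nlinarith [al_pos]
      have h1 : 20*t*X^2 ≤ 4*X^2*(n+(al+11/2)*t) := by
        have : 0 ≤ al * t := mul_nonneg al_pos.le ht0
        nlinarith [sq_nonneg X, mul_nonneg (sq_nonneg X) hn, mul_nonneg (sq_nonneg X) this,
          mul_nonneg (sq_nonneg X) ht0]
      have h2 : X*(3/4*(X-u)+5/64) + (X-u+1/8)*(X-u+5/8) ≤ 10*X^2+10*t^2 := by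
        nlinarith [sq_nonneg (X+u), sq_nonneg (X-1), mul_nonneg hu0 hu0, mul_le_mul hut hut hu0 ht0, sq_nonneg (u-1)]
      linarith
    nlinarith [mul_le_mul_of_nonneg_right hmain (hT n)]
  have sD : Summable (fun n => H n - H (n+1)) := sH.sub ((summable_nat_add_iff 1).2 sH)
  have := ((sX.mul_left (20*t-10)).sub (s0.mul_left (10*t^2))).tsum_le_tsum hpt sD
  rw [hsum, (sX.mul_left (20*t-10)).tsum_sub (s0.mul_left (10*t^2)), tsum_mul_left, tsum_mul_left] at this
  have hS : 0 ≤ SS t := tsum_nonneg hT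
  change (20*t-10) * _ - 10*t^2 * SS t ≤ 0 at this
  set V := ∑' n : ℕ, ((n:ℝ) - al*t)^2 * TT t n with hV
  have hV0 : 0 ≤ V := tsum_nonneg (fun n => mul_nonneg (sq_nonneg _) (hT n))
  have h10 : 10 * t * V ≤ 10 * t * (t * SS t) := by nlinarith
  exact le_of_mul_le_mul_left h10 (by linarith)


lemma bern_inv {w p : ℝ} (v : ℝ) (hp0 : 0 ≤ p) (hp1 : p ≤ 1) (hw : 0 < 1 + v) (hv : 0 < 1 + p*v) 
    (hwv : w = 1 / (1 + p*v)) : w ≤ (1/(1+v))^p ↔ True := by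
  simp only [iff_true]
  rw [hwv, Real.div_rpow (by norm_num) hw.le, Real.one_rpow]
  apply one_div_le_one_div_of_le (Real.rpow_pos_of_pos hw p)
  exact rpow_one_add_le_one_add_mul_self (by linarith) hp0 hp1

lemma ratio_A {x : ℝ} (n : ℕ) (hn : (n:ℝ) < x) :
    poch (1/8-x) n ≠ 0 ∧
    ((x+7/8)/(x+7/8-n))^((1:ℝ)/8) ≤ poch (-x) n / poch (1/8-x) n ∧
    poch (-x) n / poch (1/8-x) n ≤ (x/(x-n))^((1:ℝ)/8) := by
  induction n with
  | zero =>
    have h1 : x + 7/8 ≠ 0 := by simp at hn; positivity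
    have h2 : x ≠ 0 := by simp at hn; positivity
    simp [poch_zero, div_self h1, div_self h2]
  | succ n ih =>
    push_cast at hn ⊢
    have hn0 : (0:ℝ) ≤ n := Nat.cast_nonneg n
    obtain ⟨h0, h1, h2⟩ := ih (by linarith)
    obtain ⟨w, hw⟩ : ∃ w : ℝ, w = x - n := ⟨_, rfl⟩
    have hw1 : 1 < w := by linarith
    have hx : x = w + n := by linarith
    have hne : 1/8 - x + n ≠ 0 := by rw [hx]; apply ne_of_lt; linarith
    have efac : poch (-x) (n+1) / poch (1/8-x) (n+1) = poch (-x) n / poch (1/8-x) n * (w/(w-1/8)) := by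
      rw [poch_succ, poch_succ, mul_div_mul_comm]
      congr 1
      rw [div_eq_div_iff hne (by linarith)]
      rw [hx]; ring
    have hq : 0 ≤ w/(w-1/8) := div_nonneg (by linarith) (by linarith)
    refine ⟨?_, ?_, ?_⟩
    · rw [poch_succ]; exact mul_ne_zero h0 hne
    · rw [efac]
      have hb : ((w+7/8)/(w-1/8))^((1:ℝ)/8) ≤ w/(w-1/8) := by
        have := rpow_one_add_le_one_add_mul_self (s := 1/(w-1/8)) (p := 1/8)
          (by have : 0 < 1/(w-1/8) := one_div_pos.2 (by linarith)
              linarith) (by norm_num) (by norm_num)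
        have hw8 : w - 1/8 ≠ 0 := by linarith
        convert this using 1
        · congr 1; rw [div_eq_iff hw8, add_mul, one_div_mul_cancel hw8]; ring
        · rw [div_eq_iff hw8, add_mul, mul_assoc, one_div_mul_cancel hw8]; ring
      calc _ = ((x+7/8)/(x+7/8-n))^((1:ℝ)/8) * ((w+7/8)/(w-1/8))^((1:ℝ)/8) := by
            rw [← Real.mul_rpow (div_nonneg (by linarith) (by linarith)) (div_nonneg (by linarith) (by linarith))]
            congr 1
            have e1 : x+7/8-n = w+7/8 := by linarith
            have e2 : x+7/8-(n+1) = w-1/8 := by linarith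
            rw [e1, e2]
            have hw8 : w - 1/8 ≠ 0 := by linarith
            have hw9 : w + 7/8 ≠ 0 := by linarith
            field_simp
        _ ≤ _ := mul_le_mul h1 hb (Real.rpow_nonneg (div_nonneg (by linarith) (by linarith)) _)
            (le_trans (Real.rpow_nonneg (div_nonneg (by linarith) (by linarith)) _) h1)
    · rw [efac]
      have hb : w/(w-1/8) ≤ (w/(w-1))^((1:ℝ)/8) := by
        have hw0 : w ≠ 0 := by linarith
        have hwl : w - 1 ≠ 0 := by linarith
        have i1 : 1/w < 1 := by rw [div_lt_one (by linarith)]; exact hw1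
        have := (bern_inv (w := w/(w-1/8)) (p := 1/8) (-(1/w)) (by norm_num) (by norm_num)
          (by linarith) (by linarith) (by
            have hw8 : w - 1/8 ≠ 0 := by linarith
            have : 1 + 1/8 * -(1/w) = (w-1/8)/w := by field_simp; try ring
            rw [this, one_div_div])).2 trivial
        rwa [show 1/(1 + -(1/w)) = w/(w-1) by
          rw [show 1 + -(1/w) = (w-1)/w by field_simp; try ring, one_div_div]] at this
      calc _ ≤ (x/(x-n))^((1:ℝ)/8) * (w/(w-1))^((1:ℝ)/8) :=
            mul_le_mul h2 hb hq (Real.rpow_nonneg (div_nonneg (by linarith) (by linarith)) _)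
        _ = _ := by
            rw [← Real.mul_rpow (div_nonneg (by linarith) (by linarith)) (div_nonneg (by linarith) (by linarith))]
            congr 1
            rw [show x-n = w by linarith, show x-(n+1) = w-1 by linarith]
            have hw8 : w - 1 ≠ 0 := by linarith
            have hw9 : w ≠ 0 := by linarith
            field_simp

lemma ratio_C {y : ℝ} (hy : 1/2 < y) (n : ℕ) :
    ((y-1/2)/(y-1/2+n))^((1:ℝ)/2) ≤ poch y n / poch (y+1/2) n ∧
    poch y n / poch (y+1/2) n ≤ (y/(y+n))^((1:ℝ)/2) := by
  induction n with
  | zero =>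
    have h1 : y - 1/2 ≠ 0 := by linarith
    have h2 : y ≠ 0 := by linarith
    have e1 : (y-1/2)/(y-1/2) = 1 := div_self h1
    simp only [poch_zero, Nat.cast_zero, add_zero, e1, div_self h2, Real.one_rpow, div_one]
    simp
  | succ n ih =>
    push_cast
    have hn0 : (0:ℝ) ≤ n := Nat.cast_nonneg n
    obtain ⟨h1, h2⟩ := ih
    obtain ⟨w, hw⟩ : ∃ w : ℝ, w = y + n := ⟨_, rfl⟩
    have hw1 : 1/2 < w := by linarith
    have hy' : y = w - n := by linarith
    have efac : poch y (n+1) / poch (y+1/2) (n+1) = poch y n / poch (y+1/2) n * (w/(w+1/2)) := by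
      rw [poch_succ, poch_succ, mul_div_mul_comm, hw]
      congr 2; ring
    have hq : 0 ≤ w/(w+1/2) := div_nonneg (by linarith) (by linarith)
    refine ⟨?_, ?_⟩
    · rw [efac]
      have hb : ((w-1/2)/(w+1/2))^((1:ℝ)/2) ≤ w/(w+1/2) := by
        have hw8 : w + 1/2 ≠ 0 := by linarith
        have i1 : 1/(w+1/2) ≤ 1 := by rw [div_le_one (by linarith)]; linarith
        have := rpow_one_add_le_one_add_mul_self (s := -(1/(w+1/2))) (p := 1/2)
          (by linarith) (by norm_num) (by norm_num)
        convert this using 1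
        · congr 1; rw [eq_comm, ← sub_eq_zero]; field_simp; ring
        · rw [eq_comm, ← sub_eq_zero]; field_simp; ring
      calc _ = ((y-1/2)/(y-1/2+n))^((1:ℝ)/2) * ((w-1/2)/(w+1/2))^((1:ℝ)/2) := by
            rw [← Real.mul_rpow (div_nonneg (by linarith) (by linarith)) (div_nonneg (by linarith) (by linarith))]
            congr 1
            have e1 : y-1/2+n = w-1/2 := by linarith
            have e2 : y-1/2+(n+1) = w+1/2 := by linarith
            rw [e1, e2]
            have hw8 : w - 1/2 ≠ 0 := by linarith
            have hw9 : w + 1/2 ≠ 0 := by linarith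
            rw [div_mul_div_cancel₀ hw8]
        _ ≤ _ := mul_le_mul h1 hb (Real.rpow_nonneg (div_nonneg (by linarith) (by linarith)) _)
            (le_trans (Real.rpow_nonneg (div_nonneg (by linarith) (by linarith)) _) h1)
    · rw [efac]
      have hb : w/(w+1/2) ≤ (w/(w+1))^((1:ℝ)/2) := by
        have hw0 : w ≠ 0 := by linarith
        have i1 : 0 < 1/w := one_div_pos.2 (by linarith)
        have := (bern_inv (w := w/(w+1/2)) (p := 1/2) (1/w) (by norm_num) (by norm_num)
          (by linarith) (by linarith) (by
            have : 1 + 1/2 * (1/w) = (w+1/2)/w := by field_simp; try ring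
            rw [this, one_div_div])).2 trivial
        rwa [show 1/(1 + (1/w)) = w/(w+1) by
          rw [show 1 + (1/w) = (w+1)/w by field_simp; try ring, one_div_div]] at this
      calc _ ≤ (y/(y+n))^((1:ℝ)/2) * (w/(w+1))^((1:ℝ)/2) :=
            mul_le_mul h2 hb hq (Real.rpow_nonneg (div_nonneg (by linarith) (by linarith)) _)
        _ = _ := by
            rw [← Real.mul_rpow (div_nonneg (by linarith) (by linarith)) (div_nonneg (by linarith) (by linarith))]
            congr 1
            rw [← hw, show y+(n+1) = w+1 by linarith]
            have hw9 : w ≠ 0 := by linarith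
            rw [div_mul_div_cancel₀ hw9]

lemma poch_neg_sign (s : ℝ) (hs0 : 0 ≤ s) (hs1 : s < 1) (N n : ℕ) (hn : n ≤ N) :
    0 ≤ (-1)^n * poch (s - N) n := by
  induction n with
  | zero => simp [poch_zero]
  | succ n ih =>
    have h := ih (by omega)
    have hc : ((n:ℝ)+1) ≤ N := by exact_mod_cast hn
    rw [poch_succ, pow_succ]
    have := mul_nonneg h (show 0 ≤ -(s - N + n) by linarith)
    linarith

lemma pp_nonneg {s r : ℝ} (hs0 : 0 ≤ s) (hs1 : s < 1) (hr0 : 0 ≤ r) (hr1 : r < 1) (N n : ℕ) :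
    0 ≤ poch (s - N) n * poch (r - N) n := by
  rcases le_total n N with h | h
  · have := mul_nonneg (poch_neg_sign s hs0 hs1 N n h) (poch_neg_sign r hr0 hr1 N n h)
    have e : ((-1:ℝ)^n) * (-1)^n = 1 := by rw [← mul_pow]; norm_num
    calc (0:ℝ) ≤ _ := this
      _ = ((-1:ℝ)^n * (-1)^n) * (poch (s - N) n * poch (r - N) n) := by ring
      _ = _ := by rw [e, one_mul]
  · induction n, h using Nat.le_induction with
    | base =>
      have := mul_nonneg (poch_neg_sign s hs0 hs1 N N le_rfl) (poch_neg_sign r hr0 hr1 N N le_rfl)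
      have e : ((-1:ℝ)^N) * (-1)^N = 1 := by rw [← mul_pow]; norm_num
      calc (0:ℝ) ≤ _ := this
        _ = ((-1:ℝ)^N * (-1)^N) * (poch (s - N) N * poch (r - N) N) := by ring
        _ = _ := by rw [e, one_mul]
    | succ n h ih =>
      have hc : (N:ℝ) ≤ n := by exact_mod_cast h
      rw [poch_succ, poch_succ]
      have := mul_nonneg ih (mul_nonneg (show 0 ≤ s - N + n by linarith) (show 0 ≤ r - N + n by linarith))
      linarith

lemma TT_nonneg0 (N n : ℕ) : 0 ≤ TT N n := by
  unfold TT
  have h1 := poch_pos (show (0:ℝ) < 1+4*N by positivity) n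
  have h2 := poch_pos (show (0:ℝ) < 1 by positivity) n
  have h3 := pp_nonneg (s := 1/8) (r := 5/8) (by norm_num) (by norm_num) (by norm_num) (by norm_num) N n
  positivity

lemma TT_nonneg1 (N n : ℕ) : 0 ≤ TT (N+1/8) n := by
  unfold TT
  have h1 := poch_pos (show (0:ℝ) < 1+4*(N+1/8) by positivity) n
  have h2 := poch_pos (show (0:ℝ) < 1 by positivity) n
  have h3 := pp_nonneg (s := 0) (r := 1/2) (by norm_num) (by norm_num) (by norm_num) (by norm_num) N n
  rw [show (1/8 - ((N:ℝ)+1/8)) = 0 - N by ring, show (5/8 - ((N:ℝ)+1/8)) = 1/2 - N by ring]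
  positivity

noncomputable def UU (p : ℝ × ℝ) : ℝ := (1/(1-p.1))^((1:ℝ)/8) *
  ((1-p.2/2)/(1-p.2/2-p.1))^((1:ℝ)/8) * ((4+p.2)/(4+p.2+p.1))^((1:ℝ)/2)

noncomputable def LL (p : ℝ × ℝ) : ℝ := ((1+7/8*p.2)/(1+7/8*p.2-p.1))^((1:ℝ)/8) *
  ((1+3/8*p.2)/(1+3/8*p.2-p.1))^((1:ℝ)/8) * ((4+p.2/2)/(4+p.2/2+p.1))^((1:ℝ)/2)

noncomputable def Lc : ℝ := (1/(1-al))^((1:ℝ)/8) * (1/(1-al))^((1:ℝ)/8) * (4/(4+al))^((1:ℝ)/2)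

lemma TT_sandwich (N n : ℕ) (hn : (n:ℝ) < N - 1/2) :
    LL (n/N, 1/N) * TT N n ≤ TT (N+1/8) n ∧ TT (N+1/8) n ≤ UU (n/N, 1/N) * TT N n := by
  have hn0 : (0:ℝ) ≤ n := Nat.cast_nonneg n
  have hN : (0:ℝ) < N := by linarith
  obtain ⟨a0, a1, a2⟩ := ratio_A (x := N) n (by linarith)
  obtain ⟨b0, b1, b2⟩ := ratio_A (x := N - 1/2) n hn
  obtain ⟨c1, c2⟩ := ratio_C (y := 1 + 4*N) (by linarith) n
  have h1 := poch_pos (show (0:ℝ) < 1+4*N by positivity) n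
  have h1' := poch_pos (show (0:ℝ) < 1+4*N+1/2 by positivity) n
  have h2 := poch_pos (show (0:ℝ) < 1 by positivity) n
  have e : TT (N+1/8) n = poch (-N) n / poch (1/8-N) n * (poch (-(N-1/2)) n / poch (1/8-(N-1/2)) n)
      * (poch (1+4*N) n / poch (1+4*N+1/2) n) * TT N n := by
    unfold TT
    rw [show (1/8 - ((N:ℝ)+1/8)) = - N by ring, show (5/8 - ((N:ℝ)+1/8)) = -(N-1/2) by ring,
      show 1/8-((N:ℝ)-1/2) = 5/8 - N by ring, show 1+4*((N:ℝ)+1/8) = 1+4*N+1/2 by ring]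
    rw [show 1/8-((N:ℝ)-1/2) = 5/8 - N by ring] at b0
    generalize poch (1+4*N) n = x1 at *
    generalize poch (1+4*N+1/2) n = x2 at *
    generalize poch (1/8-N) n = x3 at *
    generalize poch (5/8-N) n = x4 at *
    generalize poch (-N) n = x5 at *
    generalize poch (-(N-1/2)) n = x6 at *
    field_simp
  have key : ∀ x z : ℝ, x/(N:ℝ) / (z/N) = x/z := fun x z => div_div_div_cancel_right₀ hN.ne' x z
  have eL : LL (n/N, 1/N) = (((N:ℝ)+7/8)/(N+7/8-n))^((1:ℝ)/8) *
      (((N:ℝ)-1/2+7/8)/(N-1/2+7/8-n))^((1:ℝ)/8) * ((1+4*(N:ℝ)-1/2)/(1+4*N-1/2+n))^((1:ℝ)/2) := by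
    unfold LL
    dsimp only
    rw [← key ((N:ℝ)+7/8) (N+7/8-n), ← key ((N:ℝ)-1/2+7/8) (N-1/2+7/8-n), ← key (1+4*(N:ℝ)-1/2) (1+4*N-1/2+n)]
    congr 1
    · congr 1
      · congr 2 <;> (field_simp; try ring)
      · congr 2 <;> (field_simp; try ring)
    · congr 2 <;> (field_simp; try ring)
  have eU : UU (n/N, 1/N) = ((N:ℝ)/(N-n))^((1:ℝ)/8) *
      (((N:ℝ)-1/2)/(N-1/2-n))^((1:ℝ)/8) * ((1+4*(N:ℝ))/(1+4*N+n))^((1:ℝ)/2) := by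
    unfold UU
    dsimp only
    rw [← key (N:ℝ) (N-n), ← key ((N:ℝ)-1/2) (N-1/2-n), ← key (1+4*(N:ℝ)) (1+4*N+n)]
    congr 1
    · congr 1
      · congr 2 <;> (field_simp; try ring)
      · congr 2 <;> (field_simp; try ring)
    · congr 2 <;> (field_simp; try ring)
  have p1 : 0 ≤ (((N:ℝ)+7/8)/(N+7/8-n))^((1:ℝ)/8) :=
    Real.rpow_nonneg (div_nonneg (by linarith) (by linarith)) _
  have p2 : 0 ≤ (((N:ℝ)-1/2+7/8)/(N-1/2+7/8-n))^((1:ℝ)/8) :=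
    Real.rpow_nonneg (div_nonneg (by linarith) (by linarith)) _
  have p3 : 0 ≤ ((1+4*(N:ℝ)-1/2)/(1+4*N-1/2+n))^((1:ℝ)/2) :=
    Real.rpow_nonneg (div_nonneg (by linarith) (by linarith)) _
  have hT := TT_nonneg0 N n
  rw [e, eL, eU]
  generalize poch (-N) n / poch (1/8-N) n = A at *
  generalize (poch (-(N-1/2)) n / poch (1/8-(N-1/2)) n) = B at *
  generalize poch (1+4*N) n / poch (1+4*N+1/2) n = C at *
  have hA := p1.trans a1
  have hB := p2.trans b1
  have hC := p3.trans c1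
  constructor
  · apply mul_le_mul_of_nonneg_right _ hT
    gcongr
  · apply mul_le_mul_of_nonneg_right _ hT
    have q1 := hA.trans a2
    have q2 := hB.trans b2
    gcongr

lemma SS_pos0 (N : ℕ) : 0 < SS N := by
  have := (TT_summable (t := N) (by positivity)).le_tsum 0 (fun n _ => TT_nonneg0 N n)
  rw [TT_zero] at this
  exact lt_of_lt_of_le one_pos this

lemma SS_pos1 (N : ℕ) : 0 < SS (N+1/8) := by
  have := (TT_summable (t := N+1/8) (by positivity)).le_tsum 0 (fun n _ => TT_nonneg1 N n)
  rw [TT_zero] at this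
  exact lt_of_lt_of_le one_pos this

lemma Lc_pos : 0 < Lc := by
  have := al_pos
  have h2 : 0 < 1 - al := by linarith [al_lt]
  unfold Lc
  positivity

lemma UU_cont : ContinuousAt UU (al, 0) := by
  have h1 := al_pos
  have h2 := al_lt
  have a1 : ((1:ℝ) - (al, (0:ℝ)).1) ≠ 0 := by dsimp only; linarith
  have a2 : ((1:ℝ) - (al, (0:ℝ)).2/2 - (al, (0:ℝ)).1) ≠ 0 := by dsimp only; linarith
  have a3 : ((4:ℝ) + (al, (0:ℝ)).2 + (al, (0:ℝ)).1) ≠ 0 := by dsimp only; linarith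
  unfold UU
  refine ((ContinuousAt.rpow_const ?_ (Or.inr (by norm_num))).mul
    (ContinuousAt.rpow_const ?_ (Or.inr (by norm_num)))).mul
    (ContinuousAt.rpow_const ?_ (Or.inr (by norm_num)))
  · exact ContinuousAt.div (by fun_prop) (by fun_prop) a1
  · exact ContinuousAt.div (by fun_prop) (by fun_prop) a2
  · exact ContinuousAt.div (by fun_prop) (by fun_prop) a3

lemma LL_cont : ContinuousAt LL (al, 0) := by
  have h1 := al_pos
  have h2 := al_lt
  have a1 : ((1:ℝ) + 7/8 * (al, (0:ℝ)).2 - (al, (0:ℝ)).1) ≠ 0 := by dsimp only; linarith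
  have a2 : ((1:ℝ) + 3/8 * (al, (0:ℝ)).2 - (al, (0:ℝ)).1) ≠ 0 := by dsimp only; linarith
  have a3 : ((4:ℝ) + (al, (0:ℝ)).2/2 + (al, (0:ℝ)).1) ≠ 0 := by dsimp only; linarith
  unfold LL
  refine ((ContinuousAt.rpow_const ?_ (Or.inr (by norm_num))).mul
    (ContinuousAt.rpow_const ?_ (Or.inr (by norm_num)))).mul
    (ContinuousAt.rpow_const ?_ (Or.inr (by norm_num)))
  · exact ContinuousAt.div (by fun_prop) (by fun_prop) a1
  · exact ContinuousAt.div (by fun_prop) (by fun_prop) a2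
  · exact ContinuousAt.div (by fun_prop) (by fun_prop) a3

lemma UU_val : UU (al, 0) = Lc := by simp [UU, Lc]
lemma LL_val : LL (al, 0) = Lc := by simp [LL, Lc]

lemma window {ε : ℝ} (hε : 0 < ε) : ∃ δ : ℝ, 0 < δ ∧ ∀ N : ℕ, 1/δ < N → ∀ n : ℕ,
    |(n:ℝ) - al*N| < δ * N →
    (Lc - ε) * TT N n ≤ TT (N+1/8) n ∧ TT (N+1/8) n ≤ (Lc + ε) * TT N n := by
  have hU : ∀ᶠ p in 𝓝 (al, (0:ℝ)), UU p < Lc + ε :=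
    UU_cont.eventually (gt_mem_nhds (by rw [UU_val]; linarith))
  have hL : ∀ᶠ p in 𝓝 (al, (0:ℝ)), Lc - ε < LL p :=
    LL_cont.eventually (lt_mem_nhds (by rw [LL_val]; linarith))
  obtain ⟨δ, hδ, h⟩ := Metric.eventually_nhds_iff.1 (hU.and hL)
  refine ⟨min δ (1/4), by positivity, ?_⟩
  intro N hN n hn
  set d := min δ (1/4) with hd
  have hd0 : 0 < d := by positivity
  have hdδ : d ≤ δ := min_le_left _ _
  have hd4 : d ≤ 1/4 := min_le_right _ _
  have hN0 : (0:ℝ) < N := lt_trans (by positivity) hN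
  have hdN : 1 < d * N := by rw [div_lt_iff₀ hd0] at hN; linarith
  have hN4 : (4:ℝ) < N := by nlinarith
  have hdist : dist ((n:ℝ)/N, 1/(N:ℝ)) (al, (0:ℝ)) < δ := by
    rw [Prod.dist_eq, max_lt_iff]
    constructor
    · rw [Real.dist_eq]
      have : (n:ℝ)/N - al = (n - al*N)/N := by field_simp
      rw [this, abs_div, abs_of_pos hN0, div_lt_iff₀ hN0]
      exact lt_of_lt_of_le hn (by gcongr)
    · rw [Real.dist_eq, sub_zero, abs_of_pos (by positivity), div_lt_iff₀ hN0]
      nlinarith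
  obtain ⟨u, l⟩ := h hdist
  have hnN : (n:ℝ) < N - 1/2 := by
    have := (abs_lt.1 hn).2
    have := al_lt
    nlinarith
  obtain ⟨s1, s2⟩ := TT_sandwich N n hnN
  have hT := TT_nonneg0 N n
  exact ⟨le_trans (mul_le_mul_of_nonneg_right l.le hT) s1,
    le_trans s2 (mul_le_mul_of_nonneg_right u.le hT)⟩

lemma limit_eq {M : ℝ} (hM : Tendsto (fun N : ℕ => SS (N+1/8) / SS N) atTop (𝓝 M)) : M = Lc := by
  have hinv : ∀ c : ℝ, Tendsto (fun N : ℕ => c / (N:ℝ)) atTop (𝓝 0) := fun c =>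
    tendsto_const_div_atTop_nhds_zero_nat c
  apply le_antisymm
  · apply le_of_forall_pos_le_add
    intro ε hε
    obtain ⟨δ, hδ, h⟩ := window hε
    have key : ∀ᶠ N : ℕ in atTop, SS (N+1/8) / SS N * (1 - (4/δ^2)/N) ≤ Lc + ε := by
      filter_upwards [eventually_ge_atTop 10, tendsto_natCast_atTop_atTop.eventually_gt_atTop (1/δ)] with N hN10 hN
      have hN10' : (10:ℝ) ≤ N := by exact_mod_cast hN10
      have hNp : (0:ℝ) < N := by linarith
      obtain ⟨c1, c2⟩ := conc (t := N+1/8) (by linarith) (TT_nonneg1 N)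
      have s0 := TT_summable (t := (N:ℝ)) (by positivity)
      have s1 := TT_summable (t := (N:ℝ)+1/8) (by positivity)
      have hpt : ∀ n : ℕ, TT (N+1/8) n ≤ (Lc+ε) * TT N n +
          (2/(δ*N)^2 * (((n:ℝ) - al*(N+1/8))^2 * TT (N+1/8) n) + 1/(δ*N)^2 * TT (N+1/8) n) := by
        intro n
        have t0 := TT_nonneg0 N n
        have t1 := TT_nonneg1 N n
        rcases lt_or_ge |(n:ℝ) - al*N| (δ*N) with hw | hw
        · have := (h N hN n hw).2
          have : 0 ≤ (2/(δ*N)^2 * (((n:ℝ) - al*(N+1/8))^2 * TT (N+1/8) n) + 1/(δ*N)^2 * TT (N+1/8) n) := by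
            positivity
          linarith
        · have hsq : (δ*N)^2 ≤ ((n:ℝ) - al*N)^2 := by
            rw [← sq_abs ((n:ℝ) - al*N)]; gcongr
          have h2 : (δ*N)^2 ≤ 2*((n:ℝ) - al*(N+1/8))^2 + 1 := by
            have a1 := al_pos
            have a2 := al_lt
            nlinarith [sq_nonneg ((n:ℝ) - al*N - 2*(al*1/8))]
          have h3 : 1 ≤ (2*((n:ℝ) - al*(N+1/8))^2 + 1) / (δ*N)^2 := by
            rw [le_div_iff₀ (by positivity)]; linarith
          have h4 := mul_le_mul_of_nonneg_right h3 t1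
          have h5 : 0 ≤ (Lc+ε) * TT N n := mul_nonneg (by linarith [Lc_pos]) t0
          calc _ ≤ (2*((n:ℝ) - al*(N+1/8))^2 + 1) / (δ*N)^2 * TT (N+1/8) n := by linarith
            _ = (2/(δ*N)^2 * (((n:ℝ) - al*(N+1/8))^2 * TT (N+1/8) n) + 1/(δ*N)^2 * TT (N+1/8) n) := by ring
            _ ≤ _ := by linarith
      have := s1.tsum_le_tsum hpt ((s0.mul_left _).add ((c1.mul_left _).add (s1.mul_left _)))
      rw [(s0.mul_left _).tsum_add ((c1.mul_left _).add (s1.mul_left _)),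
        (c1.mul_left _).tsum_add (s1.mul_left _), tsum_mul_left, tsum_mul_left, tsum_mul_left] at this
      change SS (N+1/8) ≤ (Lc+ε) * SS N + (2/(δ*N)^2 * _ + 1/(δ*N)^2 * SS (N+1/8)) at this
      have p0 := SS_pos0 N
      have p1 := SS_pos1 N
      have h6 : 2/(δ*N)^2 * (∑' n : ℕ, ((n:ℝ) - al*(N+1/8))^2 * TT (N+1/8) n) ≤
        2/(δ*N)^2 * ((N+1/8) * SS (N+1/8)) := by gcongr
      have h7 : 2/(δ*N)^2 * ((N+1/8) * SS (N+1/8)) + 1/(δ*N)^2 * SS (N+1/8) ≤ (4/δ^2)/N * SS (N+1/8) := by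
        rw [show 2/(δ*N)^2 * ((N+1/8) * SS (N+1/8)) + 1/(δ*N)^2 * SS (N+1/8) =
          ((2*N+5/4)/(δ*N)^2) * SS (N+1/8) by ring]
        apply mul_le_mul_of_nonneg_right _ p1.le
        rw [div_div, div_le_div_iff₀ (by positivity) (by positivity)]
        have : 0 < δ^2 * N := by positivity
        nlinarith
      rw [div_mul_eq_mul_div, div_le_iff₀ p0]
      linarith
    have hlim : Tendsto (fun N : ℕ => SS (N+1/8) / SS N * (1 - (4/δ^2)/N)) atTop (𝓝 (M * (1 - 0))) :=
      hM.mul (tendsto_const_nhds.sub (hinv _))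
    have := le_of_tendsto hlim key
    simpa using this
  · apply le_of_forall_pos_le_add
    intro ε hε
    obtain ⟨δ, hδ, h⟩ := window hε
    have key : ∀ᶠ N : ℕ in atTop, (Lc - ε) - (Lc/δ^2)/N ≤ SS (N+1/8) / SS N := by
      filter_upwards [eventually_ge_atTop 10, tendsto_natCast_atTop_atTop.eventually_gt_atTop (1/δ)] with N hN10 hN
      have hN10' : (10:ℝ) ≤ N := by exact_mod_cast hN10
      have hNp : (0:ℝ) < N := by linarith
      obtain ⟨c1, c2⟩ := conc (t := N) (by linarith) (TT_nonneg0 N)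
      have s0 := TT_summable (t := (N:ℝ)) (by positivity)
      have s1 := TT_summable (t := (N:ℝ)+1/8) (by positivity)
      have hL := Lc_pos
      have hpt : ∀ n : ℕ, (Lc-ε) * TT N n - 
          Lc/(δ*N)^2 * (((n:ℝ) - al*N)^2 * TT N n) ≤ TT (N+1/8) n := by
        intro n
        have t0 := TT_nonneg0 N n
        have t1 := TT_nonneg1 N n
        rcases lt_or_ge |(n:ℝ) - al*N| (δ*N) with hw | hw
        · have := (h N hN n hw).1
          have : 0 ≤ Lc/(δ*N)^2 * (((n:ℝ) - al*N)^2 * TT N n) := by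
            positivity
          linarith
        · have hsq : (δ*N)^2 ≤ ((n:ℝ) - al*N)^2 := by
            rw [← sq_abs ((n:ℝ) - al*N)]; gcongr
          have h3 : 1 ≤ ((n:ℝ) - al*N)^2 / (δ*N)^2 := by
            rw [le_div_iff₀ (by positivity)]; linarith
          have h4 := mul_le_mul_of_nonneg_right h3 (mul_nonneg hL.le t0)
          have h5 : 0 ≤ ε * TT N n := mul_nonneg hε.le t0
          have e : Lc/(δ*N)^2 * (((n:ℝ) - al*N)^2 * TT N n) = ((n:ℝ) - al*N)^2 / (δ*N)^2 * (Lc * TT N n) := by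
            ring
          rw [e]
          linarith
      have := ((s0.mul_left _).sub (c1.mul_left _)).tsum_le_tsum hpt s1
      rw [(s0.mul_left _).tsum_sub (c1.mul_left _), tsum_mul_left, tsum_mul_left] at this
      change (Lc-ε) * SS N - Lc/(δ*N)^2 * _ ≤ SS (N+1/8) at this
      have p0 := SS_pos0 N
      have h6 : Lc/(δ*N)^2 * (∑' n : ℕ, ((n:ℝ) - al*N)^2 * TT N n) ≤
        Lc/(δ*N)^2 * (N * SS N) := by gcongr
      have h7 : Lc/(δ*N)^2 * (N * SS N) = (Lc/δ^2)/N * SS N := by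
        field_simp
      rw [le_div_iff₀ p0]
      linarith
    have hlim : Tendsto (fun N : ℕ => (Lc - ε) - (Lc/δ^2)/N) atTop (𝓝 ((Lc - ε) - 0)) :=
      tendsto_const_nhds.sub (hinv _)
    have := le_of_tendsto_of_tendsto hlim hM key
    linarith

lemma Gamma_shift (s : ℝ) (hs : ∀ m : ℕ, s ≠ -m) (n : ℕ) :
    Real.Gamma (n + s) = Real.Gamma s * ∏ j ∈ Finset.range n, (s + j) := by
  induction n with
  | zero => simp
  | succ n ih =>
    rw [Finset.prod_range_succ, ← mul_assoc, ← ih]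
    have h : (n:ℝ) + s ≠ 0 := by
      intro h; exact hs n (by linarith)
    rw [show ((n+1:ℕ):ℝ) + s = (n + s) + 1 by push_cast; ring, Real.Gamma_add_one h]
    ring

noncomputable def gf (s : ℝ) (n : ℕ) : ℝ := Real.Gamma (n + 1 + s) / ((n:ℝ)^s * (n.factorial : ℝ))

lemma gf_tendsto (s : ℝ) (hs : ∀ m : ℕ, s ≠ -m) : Tendsto (gf s) atTop (𝓝 1) := by
  have h0 : Real.Gamma s ≠ 0 := Real.Gamma_ne_zero hs
  have h1 := (tendsto_const_nhds (x := Real.Gamma s)).div (Real.GammaSeq_tendsto_Gamma s) h0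
  rw [div_self h0] at h1
  refine h1.congr (fun n => ?_)
  have h2 := Gamma_shift s hs (n+1)
  push_cast at h2
  simp only [Pi.div_apply, gf, h2, Real.GammaSeq]
  rw [div_div_eq_mul_div]

noncomputable def kap : ℝ := 2^10/5^6

noncomputable def DD (t : ℝ) : ℝ :=
  kap^t * Real.Gamma (4*t+1) / (Real.Gamma (2*t+11/20) * Real.Gamma (2*t+19/20))

lemma kap_pos : 0 < kap := by unfold kap; positivity

lemma DD_pos {t : ℝ} (ht : 0 ≤ t) : 0 < DD t := by
  have h1 := Real.Gamma_pos_of_pos (show 0 < 4*t+1 by positivity)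
  have h2 := Real.Gamma_pos_of_pos (show 0 < 2*t+11/20 by positivity)
  have h3 := Real.Gamma_pos_of_pos (show 0 < 2*t+19/20 by positivity)
  have h4 := Real.rpow_pos_of_pos kap_pos t
  unfold DD; positivity

lemma DD_rec {t : ℝ} (ht : 0 ≤ t) :
    (40*t+11)*(40*t+19)*(40*t+31)*(40*t+39) * DD (t+1) =
      2^18/25 * ((1+4*t)*(2+4*t)*(3+4*t)*(4+4*t)) * DD t := by
  have h1 := Real.Gamma_pos_of_pos (show 0 < 4*t+1 by positivity)
  have h2 := Real.Gamma_pos_of_pos (show 0 < 2*t+11/20 by positivity)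
  have h3 := Real.Gamma_pos_of_pos (show 0 < 2*t+19/20 by positivity)
  have e1 : Real.Gamma (4*(t+1)+1) = (4*t+4)*((4*t+3)*((4*t+2)*((4*t+1)*Real.Gamma (4*t+1)))) := by
    rw [← Real.Gamma_add_one (by positivity), show 4*t+1+1 = 4*t+2 by ring,
      ← Real.Gamma_add_one (by positivity), show 4*t+2+1 = 4*t+3 by ring,
      ← Real.Gamma_add_one (by positivity), show 4*t+3+1 = 4*t+4 by ring,
      ← Real.Gamma_add_one (by positivity)]
    congr 1; ring
  have e2 : Real.Gamma (2*(t+1)+11/20) = (2*t+11/20+1)*((2*t+11/20)*Real.Gamma (2*t+11/20)) := by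
    rw [← Real.Gamma_add_one (by positivity),
      ← Real.Gamma_add_one (by positivity)]
    congr 1; ring
  have e3 : Real.Gamma (2*(t+1)+19/20) = (2*t+19/20+1)*((2*t+19/20)*Real.Gamma (2*t+19/20)) := by
    rw [← Real.Gamma_add_one (by positivity),
      ← Real.Gamma_add_one (by positivity)]
    congr 1; ring
  have e4 : kap^(t+1) = kap^t * (2^10/5^6) := by
    rw [Real.rpow_add kap_pos, Real.rpow_one]; rfl
  unfold DD
  rw [e1, e2, e3, e4]
  have p1 : 2*t+11/20 ≠ 0 := by positivity
  have p2 : 2*t+19/20 ≠ 0 := by positivity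
  have p3 : 2*t+11/20+1 ≠ 0 := by positivity
  have p4 : 2*t+19/20+1 ≠ 0 := by positivity
  field_simp
  ring

lemma SD_const {s : ℝ} (hs : 0 ≤ s) (N : ℕ) : SS (N+s) * DD s = SS s * DD (N+s) := by
  induction N with
  | zero => simp
  | succ N ih =>
    have hr := SS_rec (t := N+s) (by positivity)
    have hd := DD_rec (t := N+s) (by positivity)
    rw [show ((N+1:ℕ):ℝ)+s = N+s+1 by push_cast; ring]
    have hp : (40*(N+s)+11)*(40*(N+s)+19)*(40*(N+s)+31)*(40*(N+s)+39) ≠ 0 := by positivity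
    apply mul_left_cancel₀ hp
    linear_combination DD s * hr - SS s * hd + 2^18/25 * ((1+4*(N+s))*(2+4*(N+s))*(3+4*(N+s))*(4+4*(N+s))) * ih

lemma SS_eighth : SS (1/8) = 1 := by
  unfold SS
  rw [tsum_eq_single 0, TT_zero]
  intro n hn
  obtain ⟨m, rfl⟩ := Nat.exists_eq_succ_of_ne_zero hn
  have : poch 0 (m+1) = 0 := by
    have := poch_left 0 m
    rw [poch_succ]; linarith
  simp [TT, this]

lemma DD_ratio : Tendsto (fun N : ℕ => DD (N+1/8) / DD N) atTop (𝓝 (kap^((1:ℝ)/8) * √2)) := by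
  have t4 : Tendsto (fun N : ℕ => 4*N) atTop atTop := tendsto_id.const_mul_atTop' (by norm_num)
  have t2 : Tendsto (fun N : ℕ => 2*N) atTop atTop := tendsto_id.const_mul_atTop' (by norm_num)
  have nz : ∀ (p : ℤ), ¬ (20 ∣ p) → ∀ m : ℕ, (p:ℝ)/20 ≠ -m := by
    intro p hp m h
    have : (p:ℝ) = ((-20*m : ℤ):ℝ) := by push_cast; linarith
    have : p = -20*m := by exact_mod_cast this
    exact hp ⟨-m, by linarith⟩
  have g1 := (gf_tendsto _ (nz 10 (by decide))).comp t4
  have g2 := (gf_tendsto _ (nz (-9) (by decide))).comp t2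
  have g3 := (gf_tendsto _ (nz (-1) (by decide))).comp t2
  have g4 := (gf_tendsto _ (nz (-4) (by decide))).comp t2
  have g5 := (gf_tendsto _ (nz 4 (by decide))).comp t2
  have key := (((g1.mul g2).mul g3).div (g4.mul g5) (by norm_num)).const_mul (kap^((1:ℝ)/8) * √2)
  norm_num at key
  refine key.congr' ?_
  filter_upwards [eventually_ge_atTop 1] with N hN
  have hN' : (0:ℝ) < N := by exact_mod_cast hN
  simp only [Function.comp, gf, DD]
  push_cast
  rw [Real.rpow_add kap_pos, show 4*((N:ℝ)+1/8)+1 = 4*N+1+1/2 by ring,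
    show 2*((N:ℝ)+1/8)+11/20 = 2*N+1+-(1/5) by ring,
    show 2*((N:ℝ)+1/8)+19/20 = 2*N+1+1/5 by ring,
    show 2*(N:ℝ)+11/20 = 2*N+1+-(9/20) by ring,
    show 2*(N:ℝ)+19/20 = 2*N+1+-(1/20) by ring]
  have f4 : Real.Gamma (4*N+1) = ((4*N).factorial : ℝ) := by
    have := Real.Gamma_nat_eq_factorial (4*N); push_cast at this; exact this
  have q0 : (0:ℝ) < 4*N := by positivity
  have q1 : (0:ℝ) < 2*N := by positivity
  have w1 : ((4:ℝ)*N)^((1:ℝ)/2) = √2 * (2*N)^((1:ℝ)/2) := by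
    rw [Real.sqrt_eq_rpow, ← Real.mul_rpow (by norm_num) q1.le]; congr 1; ring
  have w2 : ((2:ℝ)*N)^(-(1/5:ℝ)) * (2*N)^((1:ℝ)/5) = (2*N)^((1:ℝ)/2) * ((2*N)^(-(9/20:ℝ)) * (2*N)^(-(1/20:ℝ))) := by
    rw [← Real.rpow_add q1, ← Real.rpow_add q1, ← Real.rpow_add q1]; norm_num
  have k1 := Real.Gamma_pos_of_pos (show (0:ℝ) < 2*N+1+-(9/20) by linarith)
  have k2 := Real.Gamma_pos_of_pos (show (0:ℝ) < 2*N+1+-(1/20) by linarith)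
  have k3 := Real.Gamma_pos_of_pos (show (0:ℝ) < 2*N+1+-(1/5) by linarith)
  have k4 := Real.Gamma_pos_of_pos (show (0:ℝ) < 2*N+1+(1/5) by linarith)
  rw [f4, w1]
  have r1 := Real.rpow_pos_of_pos q1 (1/2)
  have r2 := Real.rpow_pos_of_pos q1 (-(9/20))
  have r3 := Real.rpow_pos_of_pos q1 (-(1/20))
  have r4 := Real.rpow_pos_of_pos q1 (-(1/5))
  have r5 := Real.rpow_pos_of_pos q1 (1/5)
  have r6 := Real.rpow_pos_of_pos kap_pos N
  have r7 : (0:ℝ) < ((4*N).factorial : ℝ) := by positivity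
  have r8 : (0:ℝ) < ((2*N).factorial : ℝ) := by positivity
  have r9 : (0:ℝ) < √2 := by positivity
  set A1 := ((2:ℝ)*N)^((1:ℝ)/2)
  set A2 := ((2:ℝ)*N)^(-(9/20:ℝ))
  set A3 := ((2:ℝ)*N)^(-(1/20:ℝ))
  set A4 := ((2:ℝ)*N)^(-(1/5:ℝ))
  set A5 := ((2:ℝ)*N)^((1:ℝ)/5)
  set B1 := Real.Gamma (2*N+1+-(9/20))
  set B2 := Real.Gamma (2*N+1+-(1/20))
  set B3 := Real.Gamma (2*N+1+-(1/5))
  set B4 := Real.Gamma (2*N+1+1/5)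
  set B5 := Real.Gamma (4*N+1+1/2)
  have w3 : A4 = A1 * (A2 * A3) / A5 := by rw [eq_div_iff r5.ne']; exact w2
  rw [w3]
  field_simp

lemma SS0_eq : SS 0 * (DD (1/8) * Lc) = DD 0 * (kap^((1:ℝ)/8) * √2) := by
  have h8 := DD_pos (t := 1/8) (by norm_num)
  have h0 := DD_pos (t := 0) le_rfl
  have s0 : 0 < SS 0 := by simpa using SS_pos0 0
  have hl := (DD_ratio.const_mul (DD 0 / (DD (1/8) * SS 0)))
  have := limit_eq (hl.congr (fun N => ?_))
  · rw [← this]; field_simp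
  · have e1 := SD_const (s := 1/8) (by norm_num) N
    have e2 := SD_const (s := 0) le_rfl N
    rw [add_zero] at e2
    rw [SS_eighth, one_mul] at e1
    have hN := DD_pos (t := N) (by positivity)
    have hS := SS_pos0 N
    rw [← e1, eq_div_iff hS.ne']
    generalize SS ((N:ℝ)+1/8) = Q
    field_simp
    linear_combination Q * e2

lemma Lc_sq : 1 / Lc^2 = 5/4 * √(5/8) := by
  have h1 := al_lt
  have h0 := al_pos
  have h5 := sqrt5_sq
  have h5p : 0 < √5 := by positivity
  have h51 : 1 < √5 := by rw [Real.lt_sqrt] <;> norm_num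
  have e1 : 1 - al = 5/8 * (√5-1)^2 := by unfold al; nlinarith
  have e2 : 4/(4+al) = 16/(5*(1+√5)) := by
    rw [div_eq_div_iff (by positivity) (by positivity)]; unfold al; ring_nf
  have hq : Lc^2 = (1/(1-al))^((1:ℝ)/2) * (4/(4+al)) := by
    have p1 : 0 < 1/(1-al) := by apply div_pos <;> linarith
    have p2 : 0 < 4/(4+al) := by positivity
    unfold Lc
    rw [← Real.rpow_add p1, mul_pow, ← Real.rpow_natCast, ← Real.rpow_natCast, ← Real.rpow_mul p1.le,
      ← Real.rpow_mul p2.le]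
    norm_num
  rw [hq, e1, e2, ← Real.sqrt_eq_rpow, Real.sqrt_div zero_le_one, Real.sqrt_mul (by norm_num),
    Real.sqrt_sq (by linarith), Real.sqrt_one]
  have : 0 < √(5/8:ℝ) := by positivity
  have : 0 < √5 - 1 := by linarith
  field_simp
  nlinarith

lemma SS0_sq : SS 0 ^ 2 = (8*π/25) / ((5-√5)/8) * (5/4 * √(5/8)) /
    (Real.Gamma (11/20) * Real.Gamma (19/20))^2 := by
  have h := SS0_eq
  have h5 := sqrt5_sq
  have h5p : 0 < √5 := by positivity
  have h53 : √5 < 3 := by rw [Real.sqrt_lt'] <;> norm_num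
  have hD0 : DD 0 = 1 / (Real.Gamma (11/20) * Real.Gamma (19/20)) := by simp [DD]
  have hrefl := Real.Gamma_mul_Gamma_one_sub (1/5)
  have g65 : Real.Gamma (6/5) = 1/5 * Real.Gamma (1/5) := by
    rw [← Real.Gamma_add_one (by norm_num)]; norm_num
  have g32 : Real.Gamma (3/2) = 1/2 * √π := by
    rw [← Real.Gamma_one_half_eq, ← Real.Gamma_add_one (by norm_num)]; norm_num
  have hk := Real.rpow_pos_of_pos kap_pos (1/8)
  have hsin : Real.sin (π/5)^2 = (5-√5)/8 := by
    have := Real.sin_sq_add_cos_sq (π/5)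
    rw [Real.cos_pi_div_five] at this
    nlinarith
  have hsp : 0 < Real.sin (π/5) := Real.sin_pos_of_pos_of_lt_pi (by positivity) (by linarith [Real.pi_pos])
  have hD8 : DD (1/8) = kap^((1:ℝ)/8) * (1/2*√π) / (1/5 * (π / Real.sin (π/5))) := by
    unfold DD
    rw [show 4*(1/8:ℝ)+1 = 3/2 by norm_num, show 2*(1/8:ℝ)+11/20 = 1 - 1/5 by norm_num,
      show 2*(1/8:ℝ)+19/20 = 6/5 by norm_num, g32, g65]
    rw [show π/5 = π*(1/5) by ring, ← hrefl]; ring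
  have hL := Lc_pos
  have a1 := Real.Gamma_pos_of_pos (show (0:ℝ) < 11/20 by norm_num)
  have a2 := Real.Gamma_pos_of_pos (show (0:ℝ) < 19/20 by norm_num)
  have hpi := Real.pi_pos
  have hsq : √π^2 = π := Real.sq_sqrt hpi.le
  have hsqp : 0 < √π := by positivity
  have h2 : √2^2 = (2:ℝ) := Real.sq_sqrt (by norm_num)
  have hS : SS 0 = 1 / (Real.Gamma (11/20) * Real.Gamma (19/20)) * (2*√π * √2 / (5 * Real.sin (π/5))) / Lc := by
    rw [hD0, hD8] at h
    rw [eq_div_iff hL.ne']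
    field_simp at h ⊢
    apply mul_left_cancel₀ hsqp.ne'
    linear_combination h - 2*√2*hsq
  rw [hS, ← hsin, ← Lc_sq]
  rw [show (1 / (Real.Gamma (11/20) * Real.Gamma (19/20)) * (2*√π * √2 / (5 * Real.sin (π/5))) / Lc)^2 =
    (1 / (Real.Gamma (11/20) * Real.Gamma (19/20)))^2 * (4*√π^2*√2^2 / (25 * Real.sin (π/5)^2)) / Lc^2 by ring,
    hsq, h2]
  field_simp
  norm_num

lemma poch_one (n : ℕ) : poch 1 n = (n.factorial : ℝ) := by
  induction n with
  | zero => simp [poch_zero]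
  | succ n ih => rw [poch_succ, ih, Nat.factorial_succ]; push_cast; ring

lemma poch_le_fact {a : ℝ} (h0 : 0 < a) (h1 : a ≤ 1) (n : ℕ) : poch a n ≤ (n.factorial : ℝ) := by
  induction n with
  | zero => simp [poch_zero]
  | succ n ih =>
    rw [poch_succ, Nat.factorial_succ]; push_cast
    rw [mul_comm]
    have := (poch_pos h0 n).le
    apply mul_le_mul (by linarith) ih this (by positivity)

lemma poch_add (a : ℝ) (n m : ℕ) : poch a (n+m) = poch a n * poch (a+n) m := by
  induction m with
  | zero => simp [poch_zero]
  | succ m ih => rw [← add_assoc, poch_succ, poch_succ, ih]; push_cast; ring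

lemma multi_eq (a : ℝ) (n : ℕ) : Ring.multichoose a n = poch a n / n.factorial := by
  have h := Ring.factorial_nsmul_multichoose_eq_ascPochhammer a n
  rw [Polynomial.ascPochhammer_smeval_eq_eval, nsmul_eq_mul] at h
  rw [eq_div_iff (by positivity), mul_comm]
  exact h

lemma choose_eq_poch (a : ℝ) (n : ℕ) : Ring.choose (a + n - 1) n = poch a n / n.factorial := by
  rw [← multi_eq, Ring.choose]; congr 1; ring

lemma binom_sum (s : ℝ) {y : ℝ} (hy : |y| < 1) :
    HasSum (fun m : ℕ => poch s m / m.factorial * y^m) (1 / (1-y)^s) := by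
  have h := (Real.one_div_one_sub_rpow_hasFPowerSeriesOnBall_zero s).hasSum (y := y)
    (by simpa [Metric.mem_eball, edist_dist, dist_eq_norm] using! hy)
  simp only [zero_add] at h
  convert! h using 2 with m
  rw [FormalMultilinearSeries.ofScalars_apply_eq, choose_eq_poch, smul_eq_mul]

lemma vander (b : ℝ) (k : ℕ) :
    ∑ p ∈ Finset.HasAntidiagonal.antidiagonal k, (-1:ℝ)^p.1 * poch b p.1 / ((p.1.factorial:ℝ)^2 * p.2.factorial)
      = poch (1-b) k / (k.factorial:ℝ)^2 := by
  have h := Ring.add_choose_eq (R := ℝ) (r := -b) (s := k) k (Commute.all _ _)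
  rw [show -b + (k:ℝ) = (1-b) + k - 1 by ring, choose_eq_poch] at h
  have hk : (0:ℝ) < k.factorial := by positivity
  rw [pow_two, ← div_div, h, Finset.sum_div]
  apply Finset.sum_congr rfl
  intro p hp
  have hp' : p.1 + p.2 = k := by simpa using hp
  rw [Ring.choose_neg, choose_eq_poch, Ring.choose_natCast, ← hp', Nat.add_choose]
  have h1 : ((((p.1+p.2).factorial / (p.1.factorial * p.2.factorial) : ℕ)):ℝ) =
      ((p.1+p.2).factorial:ℝ) / (p.1.factorial * p.2.factorial) := by
    rw [Nat.cast_div (Nat.factorial_mul_factorial_dvd_factorial_add _ _) (by positivity)]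
    push_cast; rfl
  rw [h1]
  have h2 : ((p.1:ℤ).negOnePow • (poch b p.1 / (p.1.factorial:ℝ))) = (-1)^p.1 * (poch b p.1 / p.1.factorial) := by
    rw [Int.negOnePow_def]
    simp [Units.smul_def]
  rw [h2]
  field_simp

noncomputable def uu (n : ℕ) : ℝ := poch (1/8) n * poch (3/8) n / (n.factorial:ℝ)^2

noncomputable def FF (p : ℕ × ℕ) : ℝ :=
  poch (1/8) (p.1+p.2) * ((-1)^p.1 * poch (3/8) p.1 / ((p.1.factorial:ℝ)^2 * p.2.factorial)) * (1/5)^(p.1+p.2)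

lemma FF_summable : Summable FF := by
  have hg : Summable (fun n : ℕ => (2/5:ℝ)^n) := summable_geometric_of_lt_one (by norm_num) (by norm_num)
  have hgg : Summable (fun p : ℕ × ℕ => (2/5:ℝ)^p.1 * (2/5)^p.2) :=
    hg.mul_of_nonneg hg (fun n => by positivity) (fun n => by positivity)
  refine Summable.of_norm_bounded hgg ?_
  rintro ⟨n, m⟩
  simp only [FF, Real.norm_eq_abs]
  have p1 := poch_pos (show (0:ℝ) < 1/8 by norm_num) (n+m)
  have p2 := poch_pos (show (0:ℝ) < 3/8 by norm_num) n
  have l1 := poch_le_fact (show (0:ℝ) < 1/8 by norm_num) (by norm_num) (n+m)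
  have l2 := poch_le_fact (show (0:ℝ) < 3/8 by norm_num) (by norm_num) n
  rw [abs_mul, abs_mul, abs_div, abs_mul, abs_pow, abs_neg, abs_one, one_pow, one_mul, abs_of_pos p1, abs_of_pos p2,
    abs_of_pos (show (0:ℝ) < (n.factorial:ℝ)^2 * m.factorial by positivity),
    abs_of_pos (show (0:ℝ) < (1/5)^(n+m) by positivity)]
  have hc : ((n+m).choose n : ℝ) ≤ 2^(n+m) := by exact_mod_cast Nat.choose_le_two_pow _ _
  have he : ((n+m).choose n : ℝ) * (n.factorial * m.factorial) = (n+m).factorial := by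
    have := Nat.add_choose_mul_factorial_mul_factorial n m
    rw [Nat.choose_symm_add, ← mul_assoc]; exact_mod_cast this
  calc poch (1/8) (n+m) * (poch (3/8) n / ((n.factorial:ℝ)^2 * m.factorial)) * (1/5)^(n+m)
      ≤ (n+m).factorial * (n.factorial / ((n.factorial:ℝ)^2 * m.factorial)) * (1/5)^(n+m) := by gcongr
    _ = ((n+m).choose n : ℝ) * (1/5)^(n+m) := by rw [← he]; field_simp
    _ ≤ 2^(n+m) * (1/5)^(n+m) := by gcongr
    _ = (2/5)^n * (2/5)^m := by rw [← mul_pow, ← pow_add]; norm_num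

lemma pfaff : (5/4:ℝ)^((1:ℝ)/8) * ∑' n, uu n * (-1/4)^n = SS 0 := by
  have e1 : ∑' p, FF p = ∑' n, ∑' m, FF (n, m) := FF_summable.tsum_prod
  have e2 : ∀ n, ∑' m, FF (n, m) = (5/4:ℝ)^((1:ℝ)/8) * (uu n * (-1/4)^n) := by
    intro n
    have h := (binom_sum (1/8+n) (y := 1/5) (by norm_num [abs_of_pos])).mul_left (uu n * (-1/5)^n)
    have hc : (fun m => FF (n, m)) = fun m => uu n * (-1/5)^n * (poch (1/8+n) m / m.factorial * (1/5)^m) := by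
      funext m
      simp only [FF, uu, poch_add]
      rw [show (-1/5:ℝ)^n = (-1)^n * (1/5)^n by rw [← mul_pow]; norm_num, pow_add]
      field_simp
    rw [hc, h.tsum_eq]
    have : (1:ℝ) / (1-1/5)^((1:ℝ)/8+n) = (5/4)^((1:ℝ)/8) * (5/4)^n := by
      rw [← Real.rpow_natCast, ← Real.rpow_add (by norm_num), one_div, ← Real.inv_rpow (by norm_num)]
      norm_num
    rw [this, show (-1/4:ℝ)^n = (-1/5)^n * (5/4)^n by rw [← mul_pow]; norm_num]
    ring
  have e3 : ∑' p, FF p = ∑' k, TT 0 k := by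
    rw [← (Finset.HasAntidiagonal.sigmaAntidiagonalEquivProd (A := ℕ)).tsum_eq]
    rw [Summable.tsum_sigma' (f := fun c => FF (Finset.HasAntidiagonal.sigmaAntidiagonalEquivProd c)) (fun k => (hasSum_fintype _).summable)
      ((Equiv.summable_iff (Finset.HasAntidiagonal.sigmaAntidiagonalEquivProd (A := ℕ))).2 FF_summable)]
    refine tsum_congr (fun k => ?_)
    rw [tsum_fintype]
    have : ∀ p : (Finset.HasAntidiagonal.antidiagonal k), FF (Finset.HasAntidiagonal.sigmaAntidiagonalEquivProd ⟨k, p⟩) = FF p.1 := fun p => rfl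
    simp only [this]
    rw [Finset.sum_coe_sort (Finset.HasAntidiagonal.antidiagonal k) FF]
    have hv := vander (3/8) k
    have : ∀ p ∈ Finset.HasAntidiagonal.antidiagonal k, FF p = (poch (1/8) k * (1/5)^k) *
        ((-1:ℝ)^p.1 * poch (3/8) p.1 / ((p.1.factorial:ℝ)^2 * p.2.factorial)) := by
      intro p hp
      have hp' : p.1 + p.2 = k := by simpa using hp
      simp only [FF, hp']; ring
    rw [Finset.sum_congr rfl this, ← Finset.mul_sum, hv]
    simp only [TT, mul_zero, add_zero, sub_zero, poch_one]
    rw [show (1:ℝ) - 3/8 = 5/8 by norm_num]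
    ring
  rw [SS, ← e3, e1, ← tsum_mul_left]
  exact tsum_congr (fun n => (e2 n).symm)

noncomputable def th (f : PowerSeries ℝ) : PowerSeries ℝ := PowerSeries.X * PowerSeries.derivative ℝ f

lemma coeff_th (f : PowerSeries ℝ) (n : ℕ) : PowerSeries.coeff n (th f) = n * PowerSeries.coeff n f := by
  cases n with
  | zero => simp [th]
  | succ n => rw [th, PowerSeries.coeff_succ_X_mul, PowerSeries.coeff_derivative]; push_cast; ring

lemma th_mul (f g : PowerSeries ℝ) : th (f*g) = f * th g + g * th f := by
  simp only [th, Derivation.leibniz, smul_eq_mul]; ring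

lemma th_add (f g : PowerSeries ℝ) : th (f+g) = th f + th g := by
  simp only [th, map_add]; ring

lemma th_sub (f g : PowerSeries ℝ) : th (f-g) = th f - th g := by
  simp only [th, map_sub]; ring

lemma th_nat (k : ℕ) (f : PowerSeries ℝ) : th ((k:PowerSeries ℝ)*f) = k * th f := by
  rw [th_mul]; simp [th]

lemma th_X : th PowerSeries.X = PowerSeries.X := by simp [th]

lemma coeff_nat_mul (k : ℕ) (f : PowerSeries ℝ) (n : ℕ) :
    PowerSeries.coeff n ((k:PowerSeries ℝ)*f) = k * PowerSeries.coeff n f := by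
  rw [← nsmul_eq_mul, map_nsmul, nsmul_eq_mul]

lemma uu_succ (n : ℕ) : 64 * (n+1)^2 * uu (n+1) = (64*n^2+32*n+3) * uu n := by
  simp only [uu, poch_succ, Nat.factorial_succ]
  push_cast
  field_simp
  ring

noncomputable def fs : PowerSeries ℝ := PowerSeries.mk uu

lemma fs_ode : ((64:ℕ):PowerSeries ℝ) * th (th fs) - PowerSeries.X * (((64:ℕ):PowerSeries ℝ) * th (th fs)) =
    PowerSeries.X * (((32:ℕ):PowerSeries ℝ) * th fs + ((3:ℕ):PowerSeries ℝ) * fs) := by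
  ext n
  cases n with
  | zero => rw [map_sub, coeff_nat_mul, coeff_th]; simp
  | succ n =>
    rw [map_sub, PowerSeries.coeff_succ_X_mul, PowerSeries.coeff_succ_X_mul, map_add]
    simp only [coeff_nat_mul, coeff_th, fs, PowerSeries.coeff_mk]
    have := uu_succ n
    push_cast
    linear_combination this

lemma gs_ode : ((32:ℕ):PowerSeries ℝ) * th (th (th (fs*fs))) -
      PowerSeries.X * (((32:ℕ):PowerSeries ℝ) * th (th (th (fs*fs)))) =
    PowerSeries.X * (((48:ℕ):PowerSeries ℝ) * th (th (fs*fs)) + ((22:ℕ):PowerSeries ℝ) * th (fs*fs)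
      + ((3:ℕ):PowerSeries ℝ) * (fs*fs)) := by
  have h := fs_ode
  have h' := congrArg th h
  simp only [th_sub, th_mul, th_add, th_X] at h' ⊢
  simp only [show ∀ k : ℕ, th (k:PowerSeries ℝ) = 0 from fun k => by simp [th]] at h' ⊢
  push_cast at h h' ⊢
  linear_combination 3 * th fs * h + fs * h'

lemma gs_coeff (n : ℕ) : ∑ p ∈ Finset.HasAntidiagonal.antidiagonal n, uu p.1 * uu p.2 =
    poch (1/2) n * poch (1/4) n * poch (3/4) n / (poch 1 n)^3 := by
  have hg : ∀ n, ∑ p ∈ Finset.HasAntidiagonal.antidiagonal n, uu p.1 * uu p.2 = PowerSeries.coeff n (fs*fs) := by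
    intro n
    rw [PowerSeries.coeff_mul]; simp [fs]
  rw [hg]
  induction n with
  | zero => rw [← hg]; simp [uu, poch_zero]
  | succ n ih =>
    have h := congrArg (PowerSeries.coeff (n+1)) gs_ode
    rw [map_sub, PowerSeries.coeff_succ_X_mul, PowerSeries.coeff_succ_X_mul, map_add, map_add] at h
    simp only [coeff_nat_mul, coeff_th, ih] at h
    push_cast at h
    have h1 := poch_pos (show (0:ℝ) < 1 by norm_num) n
    have h2 : (0:ℝ) < 1 + n := by positivity
    simp only [poch_succ]
    rw [eq_div_iff (by positivity)]
    have h3 : 32 * ((n:ℝ)+1)^3 * PowerSeries.coeff (n+1) (fs*fs) =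
      (32*n^3+48*n^2+22*n+3) * (poch (1/2) n * poch (1/4) n * poch (3/4) n / (poch 1 n)^3) := by
      linear_combination h
    have h4 : poch (1/2) n * poch (1/4) n * poch (3/4) n / (poch 1 n)^3 * (poch 1 n)^3 =
      poch (1/2) n * poch (1/4) n * poch (3/4) n := by field_simp
    linear_combination (poch 1 n)^3/32 * h3 + (32*n^3+48*n^2+22*n+3)/32 * h4

lemma uu_summable : Summable (fun n => ‖uu n * (-1/4:ℝ)^n‖) := by
  refine Summable.of_nonneg_of_le (fun n => norm_nonneg _) (fun n => ?_)
    (summable_geometric_of_lt_one (r := (1/4:ℝ)) (by norm_num) (by norm_num))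
  rw [norm_mul, norm_pow, show ‖(-1/4:ℝ)‖ = 1/4 by norm_num]
  have p1 := poch_pos (show (0:ℝ) < 1/8 by norm_num) n
  have p2 := poch_pos (show (0:ℝ) < 3/8 by norm_num) n
  have l1 := poch_le_fact (show (0:ℝ) < 1/8 by norm_num) (by norm_num) n
  have l2 := poch_le_fact (show (0:ℝ) < 3/8 by norm_num) (by norm_num) n
  have : ‖uu n‖ ≤ 1 := by
    unfold uu
    rw [Real.norm_of_nonneg (by positivity), div_le_one (by positivity), pow_two]
    gcongr
  calc ‖uu n‖ * (1/4)^n ≤ 1 * (1/4)^n := by gcongr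
    _ = _ := one_mul _

lemma clausen : ∑' n : ℕ, (poch (1/2) n * poch (1/4) n * poch (3/4) n) / (poch 1 n)^3 * ((1:ℝ)) * ((-1:ℝ)/4)^n
    = (∑' n, uu n * (-1/4:ℝ)^n)^2 := by
  rw [pow_two, tsum_mul_tsum_eq_tsum_sum_antidiagonal_of_summable_norm uu_summable uu_summable]
  refine tsum_congr (fun n => ?_)
  rw [mul_one, ← gs_coeff, Finset.sum_mul]
  apply Finset.sum_congr rfl
  intro p hp
  have hp' : p.1 + p.2 = n := by simpa using hp
  rw [← hp', pow_add]; ring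

theorem stmt_13 :
    ∑' n : ℕ, (poch (1/2) n * poch (1/4) n * poch (3/4) n) / (poch 1 n)^3 * ((1:ℝ)) * ((-1:ℝ)/4)^n = (2/25) * (5:ℝ)^((1:ℝ)/4) * (5 + Real.sqrt 5) * π / ((Real.Gamma (11/20))^2 * (Real.Gamma (19/20))^2) := by
  rw [clausen]
  have hp := pfaff
  revert hp
  generalize (∑' n, uu n * (-1/4:ℝ)^n) = U
  intro hp
  have h := SS0_sq
  rw [← hp, mul_pow] at h
  have hq : ((5/4:ℝ)^((1:ℝ)/8))^2 = (5/4:ℝ)^((1:ℝ)/4) := by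
    rw [← Real.rpow_natCast, ← Real.rpow_mul (by norm_num)]; norm_num
  have hr : √(5/8:ℝ) = (5:ℝ)^((1:ℝ)/4) * (5/4:ℝ)^((1:ℝ)/4) / 2 := by
    rw [← Real.mul_rpow (by norm_num) (by norm_num), show (5*(5/4):ℝ) = (5/2)^(2:ℝ) by norm_num,
      ← Real.rpow_mul (by norm_num), show (2:ℝ)*(1/4) = 1/2 by norm_num, ← Real.sqrt_eq_rpow,
      show (5/8:ℝ) = (5/2)/2^2 by norm_num, Real.sqrt_div (by norm_num), Real.sqrt_sq (by norm_num)]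
  rw [hq, hr] at h
  have hqp : 0 < (5/4:ℝ)^((1:ℝ)/4) := by positivity
  have a1 := Real.Gamma_pos_of_pos (show (0:ℝ) < 11/20 by norm_num)
  have a2 := Real.Gamma_pos_of_pos (show (0:ℝ) < 19/20 by norm_num)
  have h5 := sqrt5_sq
  have h53 : √5 < 3 := by rw [Real.sqrt_lt'] <;> norm_num
  have hinv : 1 / ((5-√5)/8) = 2/5 * (5+√5) := by
    rw [div_eq_iff (by linarith)]; nlinarith
  rw [div_eq_mul_one_div _ ((5-√5)/8), hinv] at h
  apply mul_left_cancel₀ hqp.ne'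
  rw [h]
  ring
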